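/- arXiv:2412.12900 — 2 statements merged into one kernel-verified Lean document; each statement's English description precedes it below -/
import Mathlib

section
/- For any nonempty finite set Φ of nonzero vectors in ℝ^N, the graph shift-invariant space generated by Φ equals the bandlimited space determined by the spectral supports of the generators: H(Φ) = B_Ω with Ω = ∪_{φ ∈ Φ} supp φ̂. -/
open Matrix

/-- `S^α = S 0 ^ α 0 * S 1 ^ α 1 * ⋯ * S (L-1) ^ α (L-1)`. -/
def Spow {N L : ℕ} (S : Fin L → Matrix (Fin N) (Fin N) ℝ) (α : Fin L → ℕ) :
    Matrix (Fin N) (Fin N) ℝ :=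
  (List.ofFn fun l => S l ^ α l).prod

/-- Conjugation by `U` of diagonal matrices, as a monoid homomorphism from functions to matrices. -/
def conjDiagonal {N : ℕ} (U : Matrix (Fin N) (Fin N) ℝ) (h : Uᵀ * U = 1) (h' : U * Uᵀ = 1) :
    (Fin N → ℝ) →* Matrix (Fin N) (Fin N) ℝ where
  toFun d := U * diagonal d * Uᵀ
  map_one' := by simp [h']
  map_mul' d e := by
    calc U * diagonal (d * e) * Uᵀ = U * diagonal d * 1 * diagonal e * Uᵀ := by
          rw [mul_one, Matrix.mul_assoc U (diagonal d), diagonal_mul_diagonal]; rfl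
      _ = U * diagonal d * Uᵀ * (U * diagonal e * Uᵀ) := by
          rw [← h]; simp only [Matrix.mul_assoc]

theorem Spow_eq_conj_diagonal {N L : ℕ} {S : Fin L → Matrix (Fin N) (Fin N) ℝ}
    {U : Matrix (Fin N) (Fin N) ℝ} {lam : Fin L → Fin N → ℝ} (h : Uᵀ * U = 1) (h' : U * Uᵀ = 1)
    (hdiag : ∀ l, S l = U * diagonal (lam l) * Uᵀ) (α : Fin L → ℕ) :
    Spow S α = U * diagonal (fun n => ∏ l, lam l n ^ α l) * Uᵀ := by
  have hS : ∀ l, S l = conjDiagonal U h h' (lam l) := hdiag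
  have key : Spow S α = conjDiagonal U h h' (∏ l, lam l ^ α l) := by
    rw [← List.prod_ofFn, map_list_prod, List.map_ofFn, Spow]
    simp only [hS, Function.comp_def, map_pow]
  rw [key]
  change U * diagonal (∏ l, lam l ^ α l) * Uᵀ = _
  congr 3
  ext n
  simp

/-- A polynomial vanishing at every joint spectrum vector except the `n`-th. -/
theorem exists_separating_mvPolynomial {N L : ℕ} {lam : Fin L → Fin N → ℝ}
    (hspec : ∀ n m : Fin N, (∀ l, lam l n = lam l m) → n = m) (n : Fin N) :
    ∃ p : MvPolynomial (Fin L) ℝ, MvPolynomial.eval (fun l => lam l n) p ≠ 0 ∧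
      ∀ m, m ≠ n → MvPolynomial.eval (fun l => lam l m) p = 0 := by
  have hsep : ∀ m, ∃ q : MvPolynomial (Fin L) ℝ, m ≠ n →
      MvPolynomial.eval (fun l => lam l n) q ≠ 0 ∧ MvPolynomial.eval (fun l => lam l m) q = 0 := by
    intro m
    by_cases hmn : m = n
    · exact ⟨0, fun h => absurd hmn h⟩
    · obtain ⟨l, hl⟩ : ∃ l, lam l n ≠ lam l m := by
        by_contra! hall
        exact hmn (hspec n m hall).symm
      exact ⟨.X l - .C (lam l m), fun _ => by simpa [sub_eq_zero] using hl⟩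
  choose q hq using hsep
  refine ⟨∏ m ∈ Finset.univ.erase n, q m, ?_, fun m hm => ?_⟩
  · rw [map_prod]
    exact Finset.prod_ne_zero_iff.2 fun m hm => (hq m (Finset.ne_of_mem_erase hm)).1
  · rw [map_prod]
    exact Finset.prod_eq_zero (Finset.mem_erase.2 ⟨hm, Finset.mem_univ m⟩) (hq m hm).2

/-- Shift-invariance extends from monomials to all polynomials in the shifts. -/
theorem conj_diagonal_eval_mulVec_mem {N L : ℕ} {S : Fin L → Matrix (Fin N) (Fin N) ℝ}
    {U : Matrix (Fin N) (Fin N) ℝ} {lam : Fin L → Fin N → ℝ} (h : Uᵀ * U = 1) (h' : U * Uᵀ = 1)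
    (hdiag : ∀ l, S l = U * diagonal (lam l) * Uᵀ) {W : Submodule ℝ (Fin N → ℝ)}
    {φ : Fin N → ℝ} (hW : ∀ α, Spow S α *ᵥ φ ∈ W) (p : MvPolynomial (Fin L) ℝ) :
    (U * diagonal (fun n => MvPolynomial.eval (fun l => lam l n) p) * Uᵀ) *ᵥ φ ∈ W := by
  induction p using MvPolynomial.induction_on' with
  | monomial α a =>
    have hmon : (fun n => MvPolynomial.eval (fun l => lam l n) (MvPolynomial.monomial α a)) =
        a • fun n => ∏ l, lam l n ^ α l := by
      ext n
      simp [MvPolynomial.eval_monomial, Finsupp.prod_fintype]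
    rw [hmon, diagonal_smul, Matrix.mul_smul, Matrix.smul_mul, smul_mulVec,
      ← Spow_eq_conj_diagonal h h' hdiag]
    exact W.smul_mem a (hW α)
  | add p q hp hq =>
    simp only [map_add]
    rw [← diagonal_add, Matrix.mul_add, Matrix.add_mul, add_mulVec]
    exact W.add_mem hp hq

/-- The graph shift-invariant space generated by a nonempty finite set `Φ` of nonzero
vectors equals the bandlimited space `B_Ω` with `Ω = ⋃_{φ ∈ Φ} supp φ̂`. -/
theorem stmt5 {N L : ℕ} (hN : 1 ≤ N) (hL : 1 ≤ L)
    (S : Fin L → Matrix (Fin N) (Fin N) ℝ)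
    (U : Matrix (Fin N) (Fin N) ℝ)
    (lam : Fin L → Fin N → ℝ)
    (hsymm : ∀ l, (S l)ᵀ = S l)
    (hcomm : ∀ l l', S l * S l' = S l' * S l)
    (hU : Uᵀ * U = 1 ∧ U * Uᵀ = 1)
    (hdiag : ∀ l, S l = U * Matrix.diagonal (lam l) * Uᵀ)
    (hspec : ∀ n m : Fin N, (∀ l, lam l n = lam l m) → n = m)
    (Φ : Finset (Fin N → ℝ)) (hΦ : Φ.Nonempty) (hφ : ∀ φ ∈ Φ, φ ≠ 0) :
    ∀ x : Fin N → ℝ,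
      x ∈ Submodule.span ℝ {v | ∃ α : Fin L → ℕ, ∃ φ ∈ Φ, v = Spow S α *ᵥ φ} ↔
        ∀ n ∉ ⋃ φ ∈ Φ, {n : Fin N | (Uᵀ *ᵥ φ) n ≠ 0}, (Uᵀ *ᵥ x) n = 0 := by
  intro x
  obtain ⟨h, h'⟩ := hU
  constructor
  · intro hx n hn
    have hn' : ∀ φ ∈ Φ, (Uᵀ *ᵥ φ) n = 0 := by simpa using hn
    induction hx using Submodule.span_induction with
    | mem v hv =>
      obtain ⟨α, φ, hφΦ, rfl⟩ := hv
      rw [Spow_eq_conj_diagonal h h' hdiag, mulVec_mulVec, ← Matrix.mul_assoc,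
        ← Matrix.mul_assoc, h, Matrix.one_mul, ← mulVec_mulVec, mulVec_diagonal,
        hn' φ hφΦ, mul_zero]
    | zero => simp
    | add v w _ _ hv hw => simp [mulVec_add, hv, hw]
    | smul a v _ hv => simp [mulVec_smul, hv]
  · intro hx
    have hx_eq : x = ∑ n, (Uᵀ *ᵥ x) n • (U *ᵥ Pi.single n 1) := by
      calc x = U *ᵥ (Uᵀ *ᵥ x) := by rw [mulVec_mulVec, h', one_mulVec]
        _ = _ := by
          rw [mulVec_eq_sum]
          simp [col]
    rw [hx_eq]
    refine Submodule.sum_mem _ fun n _ => ?_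
    by_cases hn : n ∈ ⋃ φ ∈ Φ, {n : Fin N | (Uᵀ *ᵥ φ) n ≠ 0}
    · refine Submodule.smul_mem _ _ ?_
      obtain ⟨φ, hφΦ, hφn⟩ : ∃ φ ∈ Φ, (Uᵀ *ᵥ φ) n ≠ 0 := by simpa using hn
      obtain ⟨p, hpn, hp⟩ := exists_separating_mvPolynomial hspec n
      have hmem := conj_diagonal_eval_mulVec_mem h h' hdiag
        (fun α => Submodule.subset_span ⟨α, φ, hφΦ, rfl⟩ :
          ∀ α, Spow S α *ᵥ φ ∈
            Submodule.span ℝ {v | ∃ α : Fin L → ℕ, ∃ φ ∈ Φ, v = Spow S α *ᵥ φ}) p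
      have hsingle : diagonal (fun m => MvPolynomial.eval (fun l => lam l m) p) *ᵥ (Uᵀ *ᵥ φ) =
          (MvPolynomial.eval (fun l => lam l n) p * (Uᵀ *ᵥ φ) n) • Pi.single n 1 := by
        ext m
        rw [mulVec_diagonal]
        by_cases hm : m = n
        · subst hm; simp
        · simp [hp m hm, hm]
      rw [← mulVec_mulVec, ← mulVec_mulVec, hsingle, mulVec_smul] at hmem
      exact (Submodule.smul_mem_iff _ (mul_ne_zero hpn hφn)).1 hmem
    · rw [hx n hn, zero_smul]
      exact Submodule.zero_mem _
end

section
/- Let Φ be a nonempty finite set of nonzero vectors in ℝ^N, let H(Φ) be the graph shift-invariant space generated by Φ, and let Ω = ∪_{φ ∈ Φ} supp φ̂. Let D be a real N×N matrix commuting with each of S_1, …, S_L, so D = U Λ_D Uᵀ with Λ_D = diag(λ_D(1), …, λ_D(N)), fix an index i₀ ∈ {1, …, N} and an integer K ≥ 1, and consider the dynamic sampling map S_{D,i₀} : x ↦ (x(i₀), (D x)(i₀), …, (D^{K−1} x)(i₀)). Then S_{D,i₀} is one-to-one on H(Φ) if and only if K ≥ #Ω, the values λ_D(n), n ∈ Ω,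 are pairwise distinct, and u_n(i₀) ≠ 0 for every n ∈ Ω. -/
open Matrix

/-- If `U` has orthonormal columns, then `U * diagonal d * Uᵀ` acts on the coefficients `Uᵀ *ᵥ x`
by pointwise multiplication with `d`. -/
lemma transpose_mulVec_conj_diagonal_mulVec {ι : Type*} [Fintype ι] [DecidableEq ι]
    {U : Matrix ι ι ℝ} (hU : Uᵀ * U = 1) (d x : ι → ℝ) :
    Uᵀ *ᵥ ((U * diagonal d * Uᵀ) *ᵥ x) = d * (Uᵀ *ᵥ x) := by
  rw [mulVec_mulVec, ← Matrix.mul_assoc, ← Matrix.mul_assoc, hU, Matrix.one_mul, ← mulVec_mulVec]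
  ext n
  simp [mulVec_diagonal]

lemma conj_diagonal_mul_conj_diagonal {ι : Type*} [Fintype ι] [DecidableEq ι]
    {U : Matrix ι ι ℝ} (hU : Uᵀ * U = 1) (d e : ι → ℝ) :
    (U * diagonal d * Uᵀ) * (U * diagonal e * Uᵀ) = U * diagonal (d * e) * Uᵀ := by
  calc (U * diagonal d * Uᵀ) * (U * diagonal e * Uᵀ)
      = U * diagonal d * (Uᵀ * U) * diagonal e * Uᵀ := by simp only [Matrix.mul_assoc]
    _ = U * diagonal (d * e) * Uᵀ := by
      rw [hU, Matrix.mul_one, Matrix.mul_assoc U, diagonal_mul_diagonal]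
      rfl

lemma conj_diagonal_pow {ι : Type*} [Fintype ι] [DecidableEq ι]
    {U : Matrix ι ι ℝ} (hU : Uᵀ * U = 1) (hU' : U * Uᵀ = 1) (d : ι → ℝ) (k : ℕ) :
    (U * diagonal d * Uᵀ) ^ k = U * diagonal (d ^ k) * Uᵀ := by
  induction k with
  | zero => simp [hU']
  | succ k ih => rw [pow_succ, ih, conj_diagonal_mul_conj_diagonal hU, pow_succ]

lemma list_prod_conj_diagonal {ι : Type*} [Fintype ι] [DecidableEq ι]
    {U : Matrix ι ι ℝ} (hU : Uᵀ * U = 1) (hU' : U * Uᵀ = 1) (ds : List (ι → ℝ)) :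
    (ds.map fun d => U * diagonal d * Uᵀ).prod = U * diagonal ds.prod * Uᵀ := by
  induction ds with
  | nil => simp [hU']
  | cons d ds ih => rw [List.map_cons, List.prod_cons, ih, conj_diagonal_mul_conj_diagonal hU,
      List.prod_cons]

lemma Spow_conj_diagonal {N L : ℕ} {U : Matrix (Fin N) (Fin N) ℝ} (hU : Uᵀ * U = 1)
    (hU' : U * Uᵀ = 1) (lam : Fin L → Fin N → ℝ) (α : Fin L → ℕ) :
    Spow (fun l => U * diagonal (lam l) * Uᵀ) α =
      U * diagonal (∏ l, lam l ^ α l) * Uᵀ := by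
  simp only [Spow, conj_diagonal_pow hU hU']
  rw [← List.prod_ofFn, ← list_prod_conj_diagonal hU hU', List.map_ofFn]
  rfl

/-- Functions separating the points of a finite type generate the algebra of all functions. -/
lemma single_mem_adjoin_of_separates {ι κ : Type*} [Fintype ι] [DecidableEq ι]
    (f : κ → ι → ℝ) (hf : ∀ n m, (∀ l, f l n = f l m) → n = m) (n : ι) :
    (Pi.single n 1 : ι → ℝ) ∈ Algebra.adjoin ℝ (Set.range f) := by
  have hsep : ∀ m, ∃ g ∈ Algebra.adjoin ℝ (Set.range f), g n = 1 ∧ (m ≠ n → g m = 0) := by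
    intro m
    by_cases hmn : m = n
    · exact ⟨1, one_mem _, rfl, fun h => absurd hmn h⟩
    obtain ⟨l, hl⟩ : ∃ l, f l n ≠ f l m := by
      by_contra! h
      exact hmn (hf n m h).symm
    refine ⟨(f l n - f l m)⁻¹ • (f l - algebraMap ℝ _ (f l m)), Subalgebra.smul_mem _ (sub_mem
      (Algebra.subset_adjoin (Set.mem_range_self l)) (Subalgebra.algebraMap_mem _ _)) _, ?_, fun _ => ?_⟩
    · simp [inv_mul_cancel₀ (sub_ne_zero.2 hl)]
    · simp
  choose g hg hgn hgm using hsep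
  have hprod : (Pi.single n 1 : ι → ℝ) = ∏ m, g m := by
    ext i
    rw [Finset.prod_apply]
    by_cases hi : i = n
    · subst hi
      simp [hgn]
    · rw [Pi.single_eq_of_ne hi]
      exact (Finset.prod_eq_zero (f := fun m => g m i) (Finset.mem_univ i) (hgm i hi)).symm
  rw [hprod]
  exact prod_mem fun m _ => hg m

/-- A graph shift-invariant space consists of the vectors whose Fourier transform is supported
in the union of the supports of the Fourier transforms of the generators. -/
lemma mem_span_Spow_iff {N L R : ℕ} {U : Matrix (Fin N) (Fin N) ℝ} (hU : Uᵀ * U = 1)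
    (hU' : U * Uᵀ = 1) (lam : Fin L → Fin N → ℝ)
    (hspec : ∀ n m : Fin N, (∀ l, lam l n = lam l m) → n = m)
    (φ : Fin R → Fin N → ℝ) (x : Fin N → ℝ) :
    x ∈ Submodule.span ℝ {v | ∃ (α : Fin L → ℕ) (r : Fin R),
        v = Spow (fun l => U * diagonal (lam l) * Uᵀ) α *ᵥ φ r} ↔
      ∀ n ∉ {n : Fin N | ∃ r, (Uᵀ *ᵥ φ r) n ≠ 0}, (Uᵀ *ᵥ x) n = 0 := by
  simp only [Spow_conj_diagonal hU hU']
  set H := Submodule.span ℝ {v | ∃ (α : Fin L → ℕ) (r : Fin R),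
    v = (U * diagonal (∏ l, lam l ^ α l) * Uᵀ) *ᵥ φ r}
  constructor
  · intro hx n hn
    have hn' : ∀ r, (Uᵀ *ᵥ φ r) n = 0 := by simpa using hn
    induction hx using Submodule.span_induction with
    | mem v hv =>
      obtain ⟨α, r, rfl⟩ := hv
      rw [transpose_mulVec_conj_diagonal_mulVec hU, Pi.mul_apply, hn', mul_zero]
    | zero => simp
    | add v w _ _ hv hw => rw [mulVec_add, Pi.add_apply, hv, hw, add_zero]
    | smul a v _ hv => rw [mulVec_smul, Pi.smul_apply, hv, smul_zero]
  · intro hx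
    have hgen : ∀ l, ∀ v ∈ H, (U * diagonal (lam l) * Uᵀ) *ᵥ v ∈ H := by
      intro l v hv
      induction hv using Submodule.span_induction with
      | mem v hv =>
        obtain ⟨α, r, rfl⟩ := hv
        refine Submodule.subset_span ⟨Pi.single l 1 + α, r, ?_⟩
        rw [mulVec_mulVec, conj_diagonal_mul_conj_diagonal hU]
        have hpow : ∏ l', lam l' ^ (Pi.single l 1 : Fin L → ℕ) l' = lam l := by
          rw [Finset.prod_eq_single l (fun l' _ h => by simp [h]) (by simp)]
          simp
        simp only [Pi.add_apply, pow_add, Finset.prod_mul_distrib, hpow]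
      | zero => simp
      | add v w _ _ hv hw => rw [mulVec_add]; exact add_mem hv hw
      | smul a v _ hv => rw [mulVec_smul]; exact H.smul_mem a hv
    have hadj : ∀ d ∈ Algebra.adjoin ℝ (Set.range lam), ∀ v ∈ H,
        (U * diagonal d * Uᵀ) *ᵥ v ∈ H := by
      intro d hd
      induction hd using Algebra.adjoin_induction with
      | mem d hd =>
        obtain ⟨l, rfl⟩ := hd
        exact hgen l
      | algebraMap a =>
        intro v hv
        have hscalar : U * diagonal (algebraMap ℝ (Fin N → ℝ) a) * Uᵀ = a • 1 := by
          have : diagonal (algebraMap ℝ (Fin N → ℝ) a) = a • (1 : Matrix (Fin N) (Fin N) ℝ) := by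
            ext i j
            simp [diagonal_apply, one_apply]
          rw [this]
          simp [hU']
        rw [hscalar, smul_mulVec, one_mulVec]
        exact H.smul_mem a hv
      | add d e _ _ hd he =>
        intro v hv
        have hadd : diagonal (d + e) = diagonal d + diagonal e := (diagonal_add d e).symm
        rw [hadd, Matrix.mul_add, Matrix.add_mul, add_mulVec]
        exact add_mem (hd v hv) (he v hv)
      | mul d e _ _ hd he =>
        intro v hv
        rw [← conj_diagonal_mul_conj_diagonal hU, ← mulVec_mulVec]
        exact hd _ (he v hv)
    have hcoef : ∀ n, U *ᵥ Pi.single n ((Uᵀ *ᵥ x) n) ∈ H := by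
      intro n
      by_cases hn : n ∈ {n : Fin N | ∃ r, (Uᵀ *ᵥ φ r) n ≠ 0}
      · obtain ⟨r, hr⟩ := hn
        have hφ : φ r ∈ H := Submodule.subset_span ⟨0, r, by simp [hU']⟩
        have hmem := H.smul_mem ((Uᵀ *ᵥ x) n / (Uᵀ *ᵥ φ r) n)
          (hadj _ (single_mem_adjoin_of_separates lam hspec n) _ hφ)
        convert hmem using 1
        rw [Matrix.mul_assoc, ← mulVec_mulVec, ← mulVec_mulVec, ← mulVec_smul]
        congr 1
        ext m
        by_cases hm : m = n
        · subst hm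
          simp [-mulVec_mulVec, mulVec_diagonal, div_mul_cancel₀ _ hr]
        · simp [-mulVec_mulVec, mulVec_diagonal, hm]
      · rw [hx n hn]
        simp
    have hsum : x = ∑ n, U *ᵥ Pi.single n ((Uᵀ *ᵥ x) n) := by
      rw [← mulVec_sum, Finset.univ_sum_single, mulVec_mulVec, hU', one_mulVec]
    rw [hsum]
    exact sum_mem fun n _ => hcoef n

/-- Weighted power moments of order less than `K` determine the coefficients supported in `Ω` if
and only if there are at least `#Ω` of them, the nodes are distinct and the weights nonzero. -/
lemma moments_determine_iff {ι : Type*} [Fintype ι] [DecidableEq ι] (Ω : Set ι) (w μ : ι → ℝ)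
    {K : ℕ} :
    (∀ c : ι → ℝ, (∀ n ∉ Ω, c n = 0) → (∀ k : Fin K, ∑ n, w n * (μ n ^ (k : ℕ) * c n) = 0) →
        c = 0) ↔
      Ω.ncard ≤ K ∧ Set.InjOn μ Ω ∧ ∀ n ∈ Ω, w n ≠ 0 := by
  classical
  constructor
  · intro h
    have hw : ∀ n ∈ Ω, w n ≠ 0 := by
      intro n hn hwn
      have hc := h (Pi.single n 1)
        (fun m hm => Pi.single_eq_of_ne (ne_of_mem_of_not_mem hn hm).symm _) (fun k => by
          simp [Pi.single_apply, hwn])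
      simpa using congrFun hc n
    refine ⟨?_, ?_, hw⟩
    · let T : (Ω → ℝ) →ₗ[ℝ] (Fin K → ℝ) :=
        LinearMap.pi fun k => ∑ n : Ω, (w n * μ n ^ (k : ℕ)) • LinearMap.proj n
      have hT : Function.Injective T := by
        rw [injective_iff_map_eq_zero]
        intro c hc
        have hext := h (fun n => if hn : n ∈ Ω then c ⟨n, hn⟩ else 0) (fun n hn => dif_neg hn)
          (fun k => by
            have hk : ∑ n : Ω, w n * μ n ^ (k : ℕ) * c n = 0 := by
              simpa [T] using congrFun hc k
            refine Eq.trans (Fintype.sum_of_injective _ Subtype.val_injective _ _ (fun n hn => ?_)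
              (fun n => ?_)).symm hk
            · have hn' : n ∉ Ω := by simpa using hn
              simp [hn']
            · simp [mul_assoc])
        ext n
        simpa using congrFun hext n
      have := LinearMap.finrank_le_finrank_of_injective hT
      rwa [Module.finrank_fintype_fun_eq_card, Module.finrank_fin_fun, ← Nat.card_eq_fintype_card,
        Nat.card_coe_set_eq] at this
    · intro n hn m hm hnm
      by_contra hne
      have hc := h (Pi.single n (w m) - Pi.single m (w n))
        (fun i hi => by
          have hin : i ≠ n := fun e => hi (e ▸ hn)
          have him : i ≠ m := fun e => hi (e ▸ hm)
          simp [hin, him])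
        (fun k => by
          simp [Pi.single_apply, mul_sub, Finset.sum_sub_distrib, hnm]
          ring)
      exact hw m hm (by simpa [hne] using congrFun hc n)
  · rintro ⟨hcard, hinj, hw⟩ c hcΩ hc
    have hpoly : ∀ p : Polynomial ℝ, p.natDegree < K → ∑ n, w n * (p.eval (μ n) * c n) = 0 := by
      intro p hp
      calc ∑ n, w n * (p.eval (μ n) * c n)
          = ∑ n, ∑ k : Fin K, p.coeff k * (w n * (μ n ^ (k : ℕ) * c n)) := by
            refine Finset.sum_congr rfl fun n _ => ?_
            rw [Polynomial.eval_eq_sum_range' hp, ← Fin.sum_univ_eq_sum_range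
              (fun k => p.coeff k * μ n ^ k), Finset.sum_mul, Finset.mul_sum]
            exact Finset.sum_congr rfl fun k _ => by ring
        _ = 0 := by
            rw [Finset.sum_comm]
            simp [← Finset.mul_sum, hc]
    ext n
    by_cases hn : n ∈ Ω
    · have hnΩ : n ∈ Ω.toFinset := by simpa using hn
      have hinj' : Set.InjOn μ (Ω.toFinset : Set ι) := by simpa using hinj
      have hdeg : (Lagrange.basis Ω.toFinset μ n).natDegree < K := by
        have hpos : 0 < Ω.toFinset.card := Finset.card_pos.2 ⟨n, hnΩ⟩
        rw [Set.ncard_eq_toFinset_card'] at hcard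
        rw [Polynomial.natDegree_eq_of_degree_eq_some (Lagrange.degree_basis hinj' hnΩ)]
        omega
      have hsum := hpoly _ hdeg
      rw [Finset.sum_eq_single n, Lagrange.eval_basis_self hinj' hnΩ, one_mul] at hsum
      · exact (mul_eq_zero.1 hsum).resolve_left (hw n hn)
      · intro m _ hmn
        by_cases hm : m ∈ Ω
        · rw [Lagrange.eval_basis_of_ne hmn.symm (by simpa using hm), zero_mul, mul_zero]
        · rw [hcΩ m hm, mul_zero, mul_zero]
      · simp
    · exact hcΩ n hn

/-- The dynamic (aggregation) sampling map
`x ↦ (x i₀, (D x) i₀, …, (D^{K−1} x) i₀)`, with state matrix `D` commuting with the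
shifts, is one-to-one on the graph shift-invariant space `H(Φ)` if and only if
`K ≥ #Ω`, the values `λ_D(n)`, `n ∈ Ω`, are pairwise distinct, and `u_n(i₀) ≠ 0` for
all `n ∈ Ω`, where `Ω = ⋃_{φ ∈ Φ} supp φ̂`. -/
theorem stmt19 {N L : ℕ} (hN : 1 ≤ N) (hL : 1 ≤ L)
    (S : Fin L → Matrix (Fin N) (Fin N) ℝ)
    (U : Matrix (Fin N) (Fin N) ℝ)
    (lam : Fin L → Fin N → ℝ)
    (hsymm : ∀ l, (S l)ᵀ = S l)
    (hcomm : ∀ l l', S l * S l' = S l' * S l)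
    (hU : Uᵀ * U = 1 ∧ U * Uᵀ = 1)
    (hdiag : ∀ l, S l = U * Matrix.diagonal (lam l) * Uᵀ)
    (hspec : ∀ n m : Fin N, (∀ l, lam l n = lam l m) → n = m)
    (R : ℕ) (hR : 1 ≤ R) (φ : Fin R → Fin N → ℝ) (hφ : ∀ r, φ r ≠ 0)
    (D : Matrix (Fin N) (Fin N) ℝ) (lamD : Fin N → ℝ)
    (hDcomm : ∀ l, D * S l = S l * D)
    (hD : D = U * Matrix.diagonal lamD * Uᵀ)
    (i₀ : Fin N) (K : ℕ) (hK : 1 ≤ K) :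
    (∀ x ∈ Submodule.span ℝ
        {v | ∃ (α : Fin L → ℕ) (r : Fin R), v = Spow S α *ᵥ φ r},
      ∀ y ∈ Submodule.span ℝ
        {v | ∃ (α : Fin L → ℕ) (r : Fin R), v = Spow S α *ᵥ φ r},
        (∀ k : Fin K, ((D ^ (k : ℕ)) *ᵥ x) i₀ = ((D ^ (k : ℕ)) *ᵥ y) i₀) → x = y) ↔
      ({n : Fin N | ∃ r, (Uᵀ *ᵥ φ r) n ≠ 0}.ncard ≤ K ∧
        Set.InjOn lamD {n : Fin N | ∃ r, (Uᵀ *ᵥ φ r) n ≠ 0} ∧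
        ∀ n ∈ {n : Fin N | ∃ r, (Uᵀ *ᵥ φ r) n ≠ 0}, U i₀ n ≠ 0) := by
  obtain ⟨hU, hU'⟩ := hU
  obtain rfl : S = fun l => U * diagonal (lam l) * Uᵀ := funext hdiag
  subst hD
  have hsample : ∀ (k : ℕ) (x : Fin N → ℝ), (((U * diagonal lamD * Uᵀ) ^ k) *ᵥ x) i₀ =
      ∑ n, U i₀ n * (lamD n ^ k * (Uᵀ *ᵥ x) n) := by
    intro k x
    rw [conj_diagonal_pow hU hU', ← mulVec_mulVec, ← mulVec_mulVec]
    simp [mulVec, dotProduct, diagonal_apply]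
  simp only [mem_span_Spow_iff hU hU' lam hspec, hsample]
  rw [← moments_determine_iff]
  constructor
  · intro h c hcΩ hc
    have hUc : Uᵀ *ᵥ (U *ᵥ c) = c := by rw [mulVec_mulVec, hU, one_mulVec]
    have hzero := h (U *ᵥ c) (by simpa only [hUc] using hcΩ) 0 (by simp)
      (fun k => by simpa [hUc] using hc k)
    rw [← hUc, hzero, mulVec_zero]
  · intro h x hx y hy hxy
    have hsub := h (Uᵀ *ᵥ x - Uᵀ *ᵥ y)
      (fun n hn => by rw [Pi.sub_apply, hx n hn, hy n hn, sub_zero])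
      (fun k => by simp only [Pi.sub_apply, mul_sub, Finset.sum_sub_distrib, hxy k, sub_self])
    have heq := congrArg (U *ᵥ ·) (sub_eq_zero.1 hsub)
    simpa [mulVec_mulVec, hU'] using heq
end
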